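/- Let d_0, d_6 ∈ ℕ and let f* : 𝔽^{d_0} → 𝔽^{d_6} be an arbitrary function. Then there exist d_1, d_2, d_3, d_4, d_5 ∈ ℕ and floating-point affine transformations φ_i : 𝔽̄^{d_{i−1}} → 𝔽̄^{d_i} for i = 1,…,6 such that φ_6(ρ(φ_5(ρ(φ_4(ρ(φ_3(ρ(φ_2(ρ(φ_1(x))))))))))) = f*(x) for all x ∈ 𝔽^{d_0}, and all values appearing in the intermediate computation are finite. In other words, every floating-point function is exactly representable by a six-layer floating-point ReLU network. -/

import Mathlib

open scoped Classical

namespace FPT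

noncomputable section

/-- Minimal exponent `𝔢_min = -2^(q-1) + 2`. -/
def emin (q : ℕ) : ℤ := -(2 ^ (q - 1) : ℤ) + 2

/-- Maximal exponent `𝔢_max = 2^(q-1) - 1`. -/
def emax (q : ℕ) : ℤ := (2 ^ (q - 1) : ℤ) - 1

/-- The set of finite floating-point numbers with `p` mantissa bits and exponent bits `q`:
normal numbers `±(1.m₁⋯m_p)·2^e = m·2^(e-p)` with `2^p ≤ |m| ≤ 2^(p+1)-1` and
`emin ≤ e ≤ emax`, together with subnormal numbers `±(0.m₁⋯m_p)·2^emin = m·2^(emin-p)`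
with `|m| ≤ 2^p - 1`. -/
def Fset (p q : ℕ) : Set ℝ :=
  {x | ∃ m e : ℤ, |m| ≤ 2 ^ (p + 1) - 1 ∧ emin q ≤ e ∧ e ≤ emax q ∧
      ((2 : ℤ) ^ p ≤ |m| ∨ e = emin q) ∧ x = (m : ℝ) * (2 : ℝ) ^ (e - (p : ℤ))}

/-- The largest positive float `Ω = (2 - 2^(-p))·2^emax`. -/
def Omega (p q : ℕ) : ℝ := (2 - (2 : ℝ) ^ (-(p : ℤ))) * (2 : ℝ) ^ (emax q)

/-- Overflow threshold `Ω + 2^(emax - p - 1)`. -/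
def thr (p q : ℕ) : ℝ := Omega p q + (2 : ℝ) ^ (emax q - (p : ℤ) - 1)

/-- `y` is a float whose last mantissa bit `m_p` is zero, i.e. `y = m·2^(e-p)` with `m` even. -/
def EvenMantissa (p q : ℕ) (y : ℝ) : Prop :=
  ∃ m e : ℤ, |m| ≤ 2 ^ (p + 1) - 1 ∧ emin q ≤ e ∧ e ≤ emax q ∧
    ((2 : ℤ) ^ p ≤ |m| ∨ e = emin q) ∧ y = (m : ℝ) * (2 : ℝ) ^ (e - (p : ℤ)) ∧ 2 ∣ m

/-- `RoundsTo p q x y` : `y` is the rounding of `x` to the nearest float, ties to even. -/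
def RoundsTo (p q : ℕ) (x y : ℝ) : Prop :=
  y ∈ Fset p q ∧ (∀ z ∈ Fset p q, |x - y| ≤ |x - z|) ∧
    ((∀ z ∈ Fset p q, |x - z| = |x - y| → z = y) ∨ EvenMantissa p q y)

/-- Extended floats `𝔽̄ = 𝔽 ∪ {-∞, +∞, NaN}` (the payload of `fin` is meant to lie in `Fset`). -/
inductive EF where
  | fin : ℝ → EF
  | pinf : EF
  | ninf : EF
  | nan : EF

/-- Rounding `⌊·⌉ : ℝ → 𝔽̄`. -/
def rnd (p q : ℕ) (x : ℝ) : EF :=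
  if thr p q ≤ x then .pinf
  else if x ≤ -thr p q then .ninf
  else .fin (Classical.epsilon (RoundsTo p q x))

/-- Floating-point addition `⊕`. -/
def fadd (p q : ℕ) : EF → EF → EF
  | .nan, _ => .nan
  | _, .nan => .nan
  | .fin x, .fin y => rnd p q (x + y)
  | .fin _, .pinf => .pinf
  | .fin _, .ninf => .ninf
  | .pinf, .fin _ => .pinf
  | .ninf, .fin _ => .ninf
  | .pinf, .pinf => .pinf
  | .ninf, .ninf => .ninf
  | .pinf, .ninf => .nan
  | .ninf, .pinf => .nan

/-- Floating-point multiplication `⊗`. -/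
def fmul (p q : ℕ) : EF → EF → EF
  | .nan, _ => .nan
  | _, .nan => .nan
  | .fin x, .fin y => rnd p q (x * y)
  | .fin x, .pinf => if 0 < x then .pinf else if x < 0 then .ninf else .nan
  | .fin x, .ninf => if 0 < x then .ninf else if x < 0 then .pinf else .nan
  | .pinf, .fin y => if 0 < y then .pinf else if y < 0 then .ninf else .nan
  | .ninf, .fin y => if 0 < y then .ninf else if y < 0 then .pinf else .nan
  | .pinf, .pinf => .pinf
  | .ninf, .ninf => .pinf
  | .pinf, .ninf => .ninf
  | .ninf, .pinf => .ninf

/-- Floating-point subtraction `x ⊖ y = x ⊕ ((-1) ⊗ y)`. -/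
def fsub (p q : ℕ) (x y : EF) : EF := fadd p q x (fmul p q (.fin (-1)) y)

/-- Floating-point division (defined for `0 ≤ x ≤ y < ∞`, `y > 0`; NaN propagates). -/
def fdiv (p q : ℕ) : EF → EF → EF
  | _, .nan => .nan
  | .nan, _ => .nan
  | .fin x, .fin y => if 0 < y then rnd p q (x / y) else .nan
  | _, _ => .nan

/-- Correctly rounded exponential `⌊exp⌉`. -/
def fexp (p q : ℕ) : EF → EF
  | .fin x => rnd p q (Real.exp x)
  | .pinf => .pinf
  | .ninf => .fin 0
  | .nan => .nan

/-- Correctly rounded ReLU `ρ = ⌊ReLU⌉`. -/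
def frelu (p q : ℕ) : EF → EF
  | .fin x => rnd p q (max x 0)
  | .pinf => .pinf
  | .ninf => .fin 0
  | .nan => .nan

/-- Left-associative floating-point sum of a list (empty sum is `0`). -/
def fsuml (p q : ℕ) : List EF → EF
  | [] => .fin 0
  | x :: xs => xs.foldl (fadd p q) x

/-- Left-associative floating-point sum `⊕_{i=1}^{n} v i` over `Fin n`. -/
def fsum (p q : ℕ) {n : ℕ} (v : Fin n → EF) : EF := fsuml p q ((List.finRange n).map v)

/-- Matrices of extended floats. -/
abbrev Mat (a b : ℕ) := Fin a → Fin b → EF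

/-- Entrywise floating-point matrix addition. -/
def madd (p q : ℕ) {a b : ℕ} (M N : Mat a b) : Mat a b := fun i j => fadd p q (M i j) (N i j)

/-- Floating-point matrix multiplication with left-associative inner sums. -/
def mmul (p q : ℕ) {a b c : ℕ} (M : Mat a b) (N : Mat b c) : Mat a c :=
  fun i k => fsum p q (fun j => fmul p q (M i j) (N j k))

/-- Maximum of two extended floats (NaN-propagating). -/
def emax2 : EF → EF → EF
  | .nan, _ => .nan
  | _, .nan => .nan
  | .pinf, _ => .pinf
  | _, .pinf => .pinf
  | .fin x, .fin y => .fin (max x y)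
  | .fin x, .ninf => .fin x
  | .ninf, y => y

/-- Maximum entry of a vector of extended floats. -/
def vmax {n : ℕ} (v : Fin n → EF) : EF := ((List.finRange n).map v).foldl emax2 .ninf

/-- Floating-point softmax `σ(x)_i = ⌊exp⌉(x_i ⊖ x_*) ⊘ (⊕_j ⌊exp⌉(x_j ⊖ x_*))`. -/
def fsoftmax (p q : ℕ) {n : ℕ} (v : Fin n → EF) : Fin n → EF := fun i =>
  fdiv p q (fexp p q (fsub p q (v i) (vmax v)))
    (fsum p q (fun j => fexp p q (fsub p q (v j) (vmax v))))

/-- Column-wise application of the floating-point softmax. -/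
def colSoftmax (p q : ℕ) {k n : ℕ} (A : Mat k n) : Mat k n :=
  fun i j => fsoftmax p q (fun i' => A i' j) i

/-- The extended float is a finite float in `𝔽`. -/
def EF.IsF (p q : ℕ) : EF → Prop
  | .fin x => x ∈ Fset p q
  | _ => False

/-- The extended float is a well-formed element of `𝔽̄`. -/
def EF.Valid (p q : ℕ) : EF → Prop
  | .fin x => x ∈ Fset p q
  | _ => True

/-- The extended float is finite (not `±∞` or NaN). -/
def EF.Finite : EF → Prop
  | .fin _ => True
  | _ => False

/-- All entries of a vector are finite floats. -/
def VecFin (p q : ℕ) {a : ℕ} (v : Fin a → EF) : Prop := ∀ i, (v i).IsF p q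

/-- All entries of a matrix are finite floats. -/
def MatFin (p q : ℕ) {a b : ℕ} (M : Mat a b) : Prop := ∀ i j, (M i j).IsF p q

/-- Embed a real matrix as a matrix of extended floats. -/
def toEF {a b : ℕ} (M : Fin a → Fin b → ℝ) : Mat a b := fun i j => .fin (M i j)

/-- Parameters of one transformer block (attention layer followed by feed-forward layer)
with `h` heads, head dimension `m`, feed-forward width `r`, hidden dimension `d`. -/
structure Block (h m r d : ℕ) where
  WK : Fin h → Fin m → Fin d → ℝ
  WQ : Fin h → Fin m → Fin d → ℝ
  WV : Fin h → Fin m → Fin d → ℝ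
  WO : Fin h → Fin d → Fin m → ℝ
  W1 : Fin r → Fin d → ℝ
  W2 : Fin d → Fin r → ℝ
  b1 : Fin r → ℝ
  b2 : Fin d → ℝ

/-- All parameters of the block are floats. -/
def Block.Valid (p q : ℕ) {h m r d : ℕ} (B : Block h m r d) : Prop :=
  (∀ i a b, B.WK i a b ∈ Fset p q) ∧ (∀ i a b, B.WQ i a b ∈ Fset p q) ∧
    (∀ i a b, B.WV i a b ∈ Fset p q) ∧ (∀ i a b, B.WO i a b ∈ Fset p q) ∧
    (∀ a b, B.W1 a b ∈ Fset p q) ∧ (∀ a b, B.W2 a b ∈ Fset p q) ∧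
    (∀ a, B.b1 a ∈ Fset p q) ∧ (∀ a, B.b2 a ∈ Fset p q)

/-- The attention layer
`AT(X) = X ⊕ (⊕_i W_i^O ⊗ ((W_i^V ⊗ X) ⊗ σ((W_i^K ⊗ X)ᵀ ⊗ (W_i^Q ⊗ X))))`. -/
def attnApply (p q : ℕ) {h m r d : ℕ} (B : Block h m r d) {n : ℕ} (X : Mat d n) : Mat d n :=
  madd p q X (fun a b =>
    fsum p q (fun i =>
      (mmul p q (toEF (B.WO i))
        (mmul p q (mmul p q (toEF (B.WV i)) X)
          (colSoftmax p q
            (mmul p q (fun u v => mmul p q (toEF (B.WK i)) X v u)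
              (mmul p q (toEF (B.WQ i)) X))))) a b))

/-- The feed-forward layer `FF(X) = X ⊕ (W₂ ⊗ ρ(W₁ ⊗ X ⊕ b₁1ᵀ) ⊕ b₂1ᵀ)`. -/
def ffApply (p q : ℕ) {h m r d : ℕ} (B : Block h m r d) {n : ℕ} (X : Mat d n) : Mat d n :=
  madd p q X
    (madd p q
      (mmul p q (toEF B.W2)
        (fun i j => frelu p q
          ((madd p q (mmul p q (toEF B.W1) X) (fun a _ => .fin (B.b1 a))) i j)))
      (fun a _ => .fin (B.b2 a)))

/-- One transformer block: `FF ∘ AT`. -/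
def Block.apply (p q : ℕ) {h m r d n : ℕ} (B : Block h m r d) (X : Mat d n) : Mat d n :=
  ffApply p q B (attnApply p q B X)

/-- Composition of a list of transformer blocks (applied from left to right). -/
def blocksApply (p q : ℕ) {h m r d n : ℕ} (L : List (Block h m r d)) (X : Mat d n) : Mat d n :=
  L.foldl (fun Y B => Block.apply p q B Y) X

/-- `f` is a floating-point transformer:
`f(X) = W_out ⊗ g(W_in ⊗ X ⊕ b_in 1ᵀ) ⊕ b_out 1ᵀ` with `g` a nonempty composition of
transformer blocks and all parameters finite floats. -/
def IsTransformer (p q din dout n : ℕ) (f : Mat din n → Mat dout n) : Prop :=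
  ∃ (h m r d : ℕ) (L : List (Block h m r d)) (Win : Fin d → Fin din → ℝ) (bin : Fin d → ℝ)
      (Wout : Fin dout → Fin d → ℝ) (bout : Fin dout → ℝ),
    0 < h ∧ 0 < m ∧ 0 < r ∧ 0 < d ∧ L ≠ [] ∧ (∀ B ∈ L, B.Valid p q) ∧
      (∀ i j, Win i j ∈ Fset p q) ∧ (∀ i, bin i ∈ Fset p q) ∧
      (∀ i j, Wout i j ∈ Fset p q) ∧ (∀ i, bout i ∈ Fset p q) ∧
      ∀ X : Mat din n,
        f X = madd p q
          (mmul p q (toEF Wout)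
            (blocksApply p q L
              (madd p q (mmul p q (toEF Win) X) (fun i _ => .fin (bin i)))))
          (fun i _ => .fin (bout i))

/-- Column permutation: column `j` of `permCols π X` is column `π j` of `X`. -/
def permCols {a n : ℕ} (π : Equiv.Perm (Fin n)) (X : Mat a n) : Mat a n := fun i j => X i (π j)

/-- The transposition `π_{(1,2)}^n` of the first two coordinates. -/
def swap12 (n : ℕ) (hn : 2 ≤ n) : Equiv.Perm (Fin n) :=
  Equiv.swap ⟨0, by omega⟩ ⟨1, by omega⟩

/-- The columns of `X` are pairwise distinct. -/
def DistinctCols {a n : ℕ} (X : Mat a n) : Prop :=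
  ∀ j k : Fin n, j ≠ k → ∃ i, X i j ≠ X i k

/-- `(α,β)`-similarity (with 1-based column index `i = j+1`). -/
def Similar {a n : ℕ} (α β : ℕ) (X Y : Mat a n) : Prop :=
  ∃ z1 z2 : Fin a → EF,
    (∀ j : Fin n, (j : ℕ) + 1 ≤ α → ∀ i, X i j = z1 i) ∧
    (∀ j : Fin n, α < (j : ℕ) + 1 → (j : ℕ) + 1 ≤ β → ∀ i, X i j = z2 i) ∧
    (∀ j : Fin n, (j : ℕ) + 1 < α → ∀ i, Y i j = z1 i) ∧
    (∀ j : Fin n, α ≤ (j : ℕ) + 1 → (j : ℕ) + 1 ≤ β → ∀ i, Y i j = z2 i) ∧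
    (∀ j : Fin n, β < (j : ℕ) + 1 → ∀ i, X i j = Y i j)

/-- The smallest float strictly greater than `x` (junk value if none exists). -/
def succF (p q : ℕ) (x : ℝ) : ℝ := sInf {y | y ∈ Fset p q ∧ x < y}

/-- Successor on extended floats: the smallest element of `𝔽 ∪ {+∞}` strictly above. -/
def succEF (p q : ℕ) : EF → EF
  | .fin r => if ∃ y ∈ Fset p q, r < y then .fin (succF p q r) else .pinf
  | e => e

/-- Floating-point affine transformation `φ(x) = W ⊗ x ⊕ b`. -/
def affApply (p q : ℕ) {a b : ℕ} (W : Fin b → Fin a → ℝ) (c : ℝ) (v : Fin a → EF) :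
    Fin b → EF :=
  fun i => fadd p q (fsum p q (fun j => fmul p q (.fin (W i j)) (v j))) (.fin c)

/-- All intermediate values of `φ(x) = W ⊗ x ⊕ b` on input `v`, including every
left-associative partial sum of the matrix–vector product, are finite. -/
def AffIntermFin (p q : ℕ) {a b : ℕ} (W : Fin b → Fin a → ℝ) (c : ℝ) (v : Fin a → EF) : Prop :=
  ∀ i : Fin b,
    (∀ k : ℕ,
      (fsuml p q (((List.finRange a).take k).map
        (fun j => fmul p q (.fin (W i j)) (v j)))).Finite) ∧
    (affApply p q W c v i).Finite

end
end FPT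

namespace FPT

/-! ### Finite floats -/

/-- The admissible range of parameters, phrased in terms of the minimal exponent. -/
structure Admissible (p q : ℕ) : Prop where
  two_le : 2 ≤ p
  emin_le : emin q ≤ -(p : ℤ) - 1

lemma emax_eq (q : ℕ) : emax q = 1 - emin q := by
  unfold emax emin; ring

lemma Fset_finite (p q : ℕ) : (Fset p q).Finite := by
  refine (((Set.finite_Icc (-(2 ^ (p + 1) - 1) : ℤ) (2 ^ (p + 1) - 1)).prod
    (Set.finite_Icc (emin q) (emax q))).image
    (fun me : ℤ × ℤ => (me.1 : ℝ) * (2 : ℝ) ^ (me.2 - (p : ℤ)))).subset ?_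
  rintro x ⟨m, e, hm, h1, h2, -, rfl⟩
  exact ⟨(m, e), ⟨abs_le.1 hm, h1, h2⟩, rfl⟩

lemma two_zpow_succ (k : ℤ) : (2 : ℝ) ^ (k + 1) = 2 * 2 ^ k := by
  rw [zpow_add_one₀ two_ne_zero, mul_comm]

lemma mem_Fset_of_abs_lt {p q : ℕ} {m e : ℤ} (hm : |m| ≤ 2 ^ (p + 1) - 1) (h1 : emin q ≤ e)
    (h2 : e ≤ emax q) : (m : ℝ) * (2 : ℝ) ^ (e - (p : ℤ)) ∈ Fset p q := by
  induction e, h1 using Int.leInduction generalizing m with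
  | base => exact ⟨m, emin q, hm, le_rfl, h2, Or.inr rfl, rfl⟩
  | succ e he ih =>
    by_cases hn : (2 : ℤ) ^ p ≤ |m|
    · exact ⟨m, e + 1, hm, by omega, h2, Or.inl hn, rfl⟩
    · have h := ih (m := 2 * m) (by rw [abs_mul, abs_two, pow_succ]; omega) (by omega)
      convert h using 1
      rw [show e + 1 - (p : ℤ) = (e - p) + 1 by ring, two_zpow_succ]
      push_cast; ring

lemma mem_Fset {p q : ℕ} {m k : ℤ} (hm : |m| ≤ 2 ^ (p + 1)) (h1 : emin q - p ≤ k)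
    (h2 : k + 1 ≤ emax q - p) : (m : ℝ) * (2 : ℝ) ^ k ∈ Fset p q := by
  rcases hm.lt_or_eq with hm | hm
  · have := mem_Fset_of_abs_lt (p := p) (q := q) (m := m) (e := k + p) (by omega) (by omega)
      (by omega)
    simpa using this
  · rw [pow_succ] at hm
    obtain ⟨n, rfl⟩ : (2 : ℤ) ∣ m := (dvd_abs 2 m).1 ⟨2 ^ p, by rw [hm]; ring⟩
    rw [abs_mul, abs_two] at hm
    have h3 : (1 : ℤ) ≤ 2 ^ p := one_le_pow₀ (by norm_num)
    have := mem_Fset_of_abs_lt (p := p) (q := q) (m := n) (e := k + 1 + p)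
      (by rw [pow_succ]; omega) (by omega) (by omega)
    convert this using 1
    rw [show k + 1 + (p : ℤ) - p = k + 1 by ring, two_zpow_succ]
    push_cast; ring

lemma zpow_mem_Fset {p q : ℕ} {k : ℤ} (hk : emin q - p ≤ k) (hk' : k ≤ emax q)
    (hpq : Admissible p q) : (2 : ℝ) ^ k ∈ Fset p q := by
  have h1 := hpq.emin_le
  have h2 := emax_eq q
  have h3 : (1 : ℤ) ≤ 2 ^ (p + 1) := one_le_pow₀ (by norm_num)
  by_cases h : k + 1 ≤ emax q - p
  · simpa using mem_Fset (p := p) (m := 1) (by simpa using h3) hk h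
  · have := mem_Fset (p := p) (q := q) (m := 2 ^ (p + 1)) (k := k - (p + 1)) (by simp)
      (by omega) (by omega)
    convert this using 1
    push_cast
    rw [← zpow_natCast, ← zpow_add₀ two_ne_zero]
    congr 1; push_cast; ring

lemma zero_mem_Fset {p q : ℕ} (hpq : Admissible p q) : (0 : ℝ) ∈ Fset p q := by
  have h1 := hpq.emin_le
  have h2 := emax_eq q
  simpa using mem_Fset (p := p) (q := q) (m := 0) (k := emin q - p) (by simp) le_rfl (by omega)

lemma one_mem_Fset {p q : ℕ} (hpq : Admissible p q) : (1 : ℝ) ∈ Fset p q := by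
  have h1 := hpq.emin_le
  have h2 := emax_eq q
  simpa using zpow_mem_Fset (k := 0) (by omega) (by omega) hpq

lemma neg_mem_Fset {p q : ℕ} {x : ℝ} (hx : x ∈ Fset p q) : -x ∈ Fset p q := by
  obtain ⟨m, e, h1, h2, h3, h4, rfl⟩ := hx
  exact ⟨-m, e, by rwa [abs_neg], h2, h3, by rwa [abs_neg], by push_cast; ring⟩

/-- Every float is an integer multiple of the smallest positive one. -/
lemma exists_eq_mul_of_mem_Fset {p q : ℕ} {x : ℝ} (hx : x ∈ Fset p q) :
    ∃ n : ℤ, x = n * (2 : ℝ) ^ (emin q - (p : ℤ)) := by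
  obtain ⟨m, e, -, h2, -, -, rfl⟩ := hx
  obtain ⟨k, rfl⟩ := Int.le.dest h2
  refine ⟨m * 2 ^ k, ?_⟩
  rw [show emin q + k - (p : ℤ) = k + (emin q - p) by ring, zpow_add₀ two_ne_zero]
  push_cast; rw [zpow_natCast]; ring

/-- The float following `m * 2 ^ (e - p)` is at least `(m + 1) * 2 ^ (e - p)`. -/
lemma succ_mul_zpow_le {p q : ℕ} {m e : ℤ} {y : ℝ} (hm0 : 0 ≤ m)
    (hm : (2 : ℤ) ^ p ≤ |m| ∨ e = emin q)
    (hy : y ∈ Fset p q) (hlt : (m : ℝ) * (2 : ℝ) ^ (e - (p : ℤ)) < y) :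
    ((m : ℝ) + 1) * (2 : ℝ) ^ (e - (p : ℤ)) ≤ y := by
  obtain ⟨m', e', h1, h2, h3, h4, rfl⟩ := hy
  have hpos : (0 : ℝ) < (2 : ℝ) ^ (e - (p : ℤ)) := by positivity
  rcases le_or_gt e e' with hee | hee
  · obtain ⟨k, rfl⟩ := Int.le.dest hee
    rw [show e + k - (p : ℤ) = k + (e - p) by ring, zpow_add₀ two_ne_zero, ← mul_assoc,
      zpow_natCast] at hlt ⊢
    have := lt_of_mul_lt_mul_right hlt hpos.le
    have : m < m' * 2 ^ k := by exact_mod_cast this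
    gcongr
    exact_mod_cast this
  · exfalso
    have hmp : (2 : ℤ) ^ p ≤ m := by
      rcases hm with hm | hm
      · rwa [abs_of_nonneg hm0] at hm
      · omega
    have h5 : m' ≤ 2 ^ (p + 1) := by have := le_abs_self m'; omega
    have h6 : (m' : ℝ) * (2 : ℝ) ^ (e' - (p : ℤ)) ≤ 2 ^ (p + 1) * (2 : ℝ) ^ (e' - (p : ℤ)) := by
      gcongr; exact_mod_cast h5
    have h7 : (2 : ℝ) ^ (p + 1) * (2 : ℝ) ^ (e' - (p : ℤ)) =
        2 ^ p * (2 : ℝ) ^ (e' + 1 - (p : ℤ)) := by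
      rw [show e' + 1 - (p : ℤ) = (e' - p) + 1 by ring, two_zpow_succ]; ring
    have h8 : (2 : ℝ) ^ p * (2 : ℝ) ^ (e' + 1 - (p : ℤ)) ≤ (m : ℝ) * (2 : ℝ) ^ (e - (p : ℤ)) := by
      gcongr
      · exact_mod_cast hmp
      · norm_num
      · omega
    linarith

lemma abs_le_Omega {p q : ℕ} {x : ℝ} (hx : x ∈ Fset p q) : |x| ≤ Omega p q := by
  obtain ⟨m, e, h1, h2, h3, h4, rfl⟩ := hx
  have hm : |(m : ℝ)| ≤ 2 ^ (p + 1) - 1 := by exact_mod_cast h1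
  have hO : Omega p q = (2 ^ (p + 1) - 1) * (2 : ℝ) ^ (emax q - (p : ℤ)) := by
    unfold Omega
    rw [zpow_sub₀ two_ne_zero, zpow_neg, zpow_natCast, pow_succ]
    field_simp
  rw [hO, abs_mul, abs_of_pos (show (0 : ℝ) < (2 : ℝ) ^ (e - (p : ℤ)) by positivity)]
  gcongr
  · have : (1 : ℝ) ≤ 2 ^ (p + 1) := one_le_pow₀ (by norm_num)
    linarith
  · norm_num

lemma Omega_add_two_le_thr {p q : ℕ} (hpq : Admissible p q) : Omega p q + 2 ≤ thr p q := by
  have h1 := hpq.emin_le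
  have h2 := emax_eq q
  unfold thr
  have : (2 : ℝ) ^ (1 : ℤ) ≤ (2 : ℝ) ^ (emax q - (p : ℤ) - 1) :=
    zpow_le_zpow_right₀ (by norm_num) (by omega)
  rw [zpow_one] at this
  linarith

lemma abs_lt_thr_of_le {p q : ℕ} (hpq : Admissible p q) {x y : ℝ} (hy : y ∈ Fset p q)
    (hxy : |x| ≤ |y|) : |x| < thr p q := by
  have := abs_le_Omega hy
  have := Omega_add_two_le_thr hpq
  linarith

lemma abs_add_lt_thr {p q : ℕ} (hpq : Admissible p q) {x y : ℝ} (hx : x ∈ Fset p q)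
    (hy : |y| ≤ 1) : |x + y| < thr p q := by
  have := abs_le_Omega hx
  have := Omega_add_two_le_thr hpq
  have := abs_add_le x y
  linarith

/-! ### Rounding -/

/-- The value of rounding a real number that does not overflow. -/
noncomputable def rndR (p q : ℕ) (x : ℝ) : ℝ := Classical.epsilon (RoundsTo p q x)

lemma evenMantissa_neg {p q : ℕ} {y : ℝ} (hy : EvenMantissa p q y) : EvenMantissa p q (-y) := by
  obtain ⟨m, e, h1, h2, h3, h4, rfl, h5⟩ := hy
  exact ⟨-m, e, by rwa [abs_neg], h2, h3, by rwa [abs_neg], by push_cast; ring,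
    (dvd_neg).2 h5⟩

/-- Of two consecutive nonnegative floats, one has an even mantissa. -/
lemma evenMantissa_or_of_nonneg {p q : ℕ} (hpq : Admissible p q) {a b : ℝ} (ha : a ∈ Fset p q)
    (hb : b ∈ Fset p q) (ha0 : 0 ≤ a) (hab : a < b)
    (hcons : ∀ z ∈ Fset p q, a < z → b ≤ z) : EvenMantissa p q a ∨ EvenMantissa p q b := by
  obtain ⟨m, e, h1, h2, h3, h4, rfl⟩ := id ha
  have hpos : (0 : ℝ) < (2 : ℝ) ^ (e - (p : ℤ)) := by positivity
  have hm0 : 0 ≤ m := by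
    have := nonneg_of_mul_nonneg_left ha0 hpos
    exact_mod_cast this
  rcases Int.even_or_odd m with hm | hm
  · exact Or.inl ⟨m, e, h1, h2, h3, h4, rfl, hm.two_dvd⟩
  right
  have hle := succ_mul_zpow_le hm0 h4 hb hab
  have hev : (2 : ℤ) ∣ m + 1 := hm.add_one.two_dvd
  rw [abs_of_nonneg hm0] at h1 h4
  have hp2 := hpq.two_le
  have key : EvenMantissa p q (((m : ℝ) + 1) * (2 : ℝ) ^ (e - (p : ℤ))) := by
    rcases h1.lt_or_eq with h5 | h5
    · refine ⟨m + 1, e, ?_, h2, h3, ?_, by push_cast; rfl, hev⟩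
      · rw [abs_of_nonneg (by omega)]; omega
      · rw [abs_of_nonneg (by omega)]; omega
    · have h6 : (m : ℝ) + 1 = 2 ^ p * 2 := by
        rw [h5]; push_cast; ring
      have h8 : ((m : ℝ) + 1) * (2 : ℝ) ^ (e - (p : ℤ)) =
          (2 : ℝ) ^ p * (2 : ℝ) ^ (e + 1 - (p : ℤ)) := by
        rw [h6, show e + 1 - (p : ℤ) = (e - p) + 1 by ring, two_zpow_succ]; ring
      have h9 : (1 : ℤ) ≤ 2 ^ p := one_le_pow₀ (by norm_num)
      refine ⟨2 ^ p, e + 1, ?_, by omega, ?_, Or.inl (le_abs_self _), by push_cast; exact h8,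
        dvd_pow_self 2 (by omega)⟩
      · rw [abs_of_nonneg (by omega), pow_succ]; omega
      · by_contra hlt
        have hee : e = emax q := by omega
        have h10 := (le_abs_self b).trans (abs_le_Omega hb)
        have h11 : Omega p q < ((m : ℝ) + 1) * (2 : ℝ) ^ (e - (p : ℤ)) := by
          rw [h6, hee]
          unfold Omega
          rw [zpow_sub₀ two_ne_zero, zpow_neg, zpow_natCast]
          have : (0 : ℝ) < 2 ^ emax q := by positivity
          have h12 : (0 : ℝ) < 2 ^ p := by positivity
          have h13 : (2 : ℝ) ^ p * 2 * (2 ^ emax q / 2 ^ p) = 2 * 2 ^ emax q := by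
            field_simp
          rw [h13]
          gcongr
          have : (0 : ℝ) < (2 ^ p)⁻¹ := by positivity
          linarith
        linarith
  have hmem : ((m : ℝ) + 1) * (2 : ℝ) ^ (e - (p : ℤ)) ∈ Fset p q := by
    obtain ⟨m', e', h1, h2, h3, h4, h5, -⟩ := key
    exact ⟨m', e', h1, h2, h3, h4, h5⟩
  have : b = ((m : ℝ) + 1) * (2 : ℝ) ^ (e - (p : ℤ)) :=
    le_antisymm (hcons _ hmem (by gcongr; linarith)) hle
  rwa [this]

lemma evenMantissa_or {p q : ℕ} (hpq : Admissible p q) {a b : ℝ} (ha : a ∈ Fset p q)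
    (hb : b ∈ Fset p q) (hab : a < b)
    (hcons : ∀ z ∈ Fset p q, z ≤ a ∨ b ≤ z) : EvenMantissa p q a ∨ EvenMantissa p q b := by
  rcases hcons 0 (zero_mem_Fset hpq) with h | h
  · exact evenMantissa_or_of_nonneg hpq ha hb h hab
      fun z hz hz' => (hcons z hz).resolve_left (not_le.2 hz')
  · have := evenMantissa_or_of_nonneg hpq (neg_mem_Fset hb) (neg_mem_Fset ha) (by linarith)
      (by linarith) fun z hz hz' => by
        rcases hcons (-z) (neg_mem_Fset hz) with h | h <;> linarith
    rcases this with h | h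
    · right; simpa using evenMantissa_neg h
    · left; simpa using evenMantissa_neg h

lemma exists_roundsTo {p q : ℕ} (hpq : Admissible p q) (x : ℝ) : ∃ y, RoundsTo p q x y := by
  obtain ⟨y, hy, hmin⟩ := Set.exists_min_image (Fset p q) (fun z => |x - z|) (Fset_finite p q)
    ⟨0, zero_mem_Fset hpq⟩
  by_cases huniq : ∀ z ∈ Fset p q, |x - z| = |x - y| → z = y
  · exact ⟨y, hy, hmin, Or.inl huniq⟩
  push Not at huniq
  obtain ⟨z, hz, hzy, hne⟩ := huniq
  have hcons : ∀ a b : ℝ, a < b → |x - a| = |x - b| → (∀ u ∈ Fset p q, |x - a| ≤ |x - u|) →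
      ∀ u ∈ Fset p q, u ≤ a ∨ b ≤ u := by
    intro a b hab heq hle u hu
    by_contra! hcon
    have h1 := hle u hu
    have h2 : x - a = -(x - b) := by
      rcases abs_eq_abs.1 heq with h | h
      · linarith
      · exact h
    rw [abs_of_pos (by linarith : 0 < x - a)] at h1
    have : |x - u| < x - a := abs_lt.2 ⟨by linarith, by linarith⟩
    linarith
  have hzmin : ∀ u ∈ Fset p q, |x - z| ≤ |x - u| := fun u hu => hzy ▸ hmin u hu
  have : EvenMantissa p q y ∨ EvenMantissa p q z := by
    rcases lt_or_gt_of_ne hne with h | h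
    · exact (evenMantissa_or hpq hz hy h (hcons z y h hzy hzmin)).symm
    · exact evenMantissa_or hpq hy hz h (hcons y z h hzy.symm hmin)
  rcases this with h | h
  · exact ⟨y, hy, hmin, Or.inr h⟩
  · exact ⟨z, hz, hzmin, Or.inr h⟩

section rndR

variable {p q : ℕ} (hpq : Admissible p q)
include hpq

lemma roundsTo_rndR (x : ℝ) : RoundsTo p q x (rndR p q x) :=
  Classical.epsilon_spec (exists_roundsTo hpq x)

lemma rndR_mem (x : ℝ) : rndR p q x ∈ Fset p q := (roundsTo_rndR hpq x).1

lemma abs_sub_rndR_le (x : ℝ) {z : ℝ} (hz : z ∈ Fset p q) : |x - rndR p q x| ≤ |x - z| :=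
  (roundsTo_rndR hpq x).2.1 z hz

lemma rndR_of_mem {x : ℝ} (hx : x ∈ Fset p q) : rndR p q x = x := by
  have h := abs_sub_rndR_le hpq x hx
  rw [sub_self, abs_zero] at h
  have := abs_nonpos_iff.1 h
  linarith

lemma rndR_mono {x y : ℝ} (hxy : x ≤ y) : rndR p q x ≤ rndR p q y := by
  rcases hxy.eq_or_lt with rfl | hxy
  · exact le_rfl
  by_contra! hlt
  have h1 := abs_sub_rndR_le hpq x (rndR_mem hpq y)
  have h2 := abs_sub_rndR_le hpq y (rndR_mem hpq x)
  have h3 := sq_le_sq.2 h1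
  have h4 := sq_le_sq.2 h2
  nlinarith

lemma rndR_le {x y : ℝ} (hy : y ∈ Fset p q) (hxy : x ≤ y) : rndR p q x ≤ y :=
  (rndR_mono hpq hxy).trans_eq (rndR_of_mem hpq hy)

lemma le_rndR {x y : ℝ} (hx : x ∈ Fset p q) (hxy : x ≤ y) : x ≤ rndR p q y :=
  (rndR_of_mem hpq hx).symm.trans_le (rndR_mono hpq hxy)

lemma max_zero_mem {x : ℝ} (hx : x ∈ Fset p q) : max x 0 ∈ Fset p q := by
  rcases max_choice x 0 with h | h <;> rw [h]
  exacts [hx, zero_mem_Fset hpq]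

omit hpq in
lemma rnd_eq {x : ℝ} (hx : |x| < thr p q) : rnd p q x = .fin (rndR p q x) := by
  rw [abs_lt] at hx
  unfold rnd
  rw [if_neg (by linarith), if_neg (by linarith)]
  rfl

lemma frelu_fin {x : ℝ} (hx : x ∈ Fset p q) : frelu p q (.fin x) = .fin (max x 0) := by
  have h := max_zero_mem hpq hx
  change rnd p q (max x 0) = _
  rw [rnd_eq (abs_lt_thr_of_le hpq h le_rfl), rndR_of_mem hpq h]

omit hpq in
lemma fadd_fin {x y : ℝ} (h : |x + y| < thr p q) :
    fadd p q (.fin x) (.fin y) = .fin (rndR p q (x + y)) := rnd_eq h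

omit hpq in
lemma fmul_fin {x y : ℝ} (h : |x * y| < thr p q) :
    fmul p q (.fin x) (.fin y) = .fin (rndR p q (x * y)) := rnd_eq h

lemma fadd_zero {x : ℝ} (hx : x ∈ Fset p q) : fadd p q (.fin x) (.fin 0) = .fin x := by
  rw [fadd_fin (by simpa using abs_lt_thr_of_le hpq hx le_rfl), add_zero, rndR_of_mem hpq hx]

lemma zero_fadd {x : ℝ} (hx : x ∈ Fset p q) : fadd p q (.fin 0) (.fin x) = .fin x := by
  rw [fadd_fin (by simpa using abs_lt_thr_of_le hpq hx le_rfl), zero_add, rndR_of_mem hpq hx]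

end rndR

end FPT

namespace FPT

/-! ### Left-associative sums and affine layers -/

/-- The left-associative floating-point sum of a list of reals, started at `0`. -/
noncomputable def foldF (p q : ℕ) (l : List ℝ) : EF :=
  (l.map EF.fin).foldl (fadd p q) (.fin 0)

lemma foldF_append_singleton (p q : ℕ) (l : List ℝ) (x : ℝ) :
    foldF p q (l ++ [x]) = fadd p q (foldF p q l) (.fin x) := by
  simp [foldF]

/-- Summing `a` along `L` yields `b`, and all partial sums are floats. -/
def SumTo (p q : ℕ) {ι : Type*} (L : List ι) (a : ι → ℝ) (b : ℝ) : Prop :=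
  (∀ k, ∃ s ∈ Fset p q, foldF p q ((L.take k).map a) = .fin s) ∧ foldF p q (L.map a) = .fin b

section sums

variable {p q : ℕ} (hpq : Admissible p q) {ι : Type*}
include hpq

lemma fsuml_map_fin {l : List ℝ} (hl : ∀ x ∈ l, x ∈ Fset p q) :
    fsuml p q (l.map EF.fin) = foldF p q l := by
  cases l with
  | nil => rfl
  | cons x xs =>
    simp only [foldF, List.map_cons, List.foldl_cons, zero_fadd hpq (hl x (by simp))]
    rfl

lemma foldF_single {l : List ι} {a : ι → ℝ} {i₀ : ι} (hl : l.Nodup) (h₀ : a i₀ ∈ Fset p q)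
    (ha : ∀ i, i ≠ i₀ → a i = 0) :
    foldF p q (l.map a) = .fin (if i₀ ∈ l then a i₀ else 0) := by
  induction l using List.reverseRecOn with
  | nil => simp [foldF]
  | append_singleton l i ih =>
    have hi : i ∉ l := by
      have := List.nodup_append.1 hl
      intro h; exact this.2.2 i h i (by simp) rfl
    rw [List.map_append, List.map_singleton, foldF_append_singleton,
      ih (List.nodup_append.1 hl).1]
    by_cases h : i = i₀
    · subst h
      simp [hi, zero_fadd hpq h₀]
    · rw [ha i h, fadd_zero hpq (by split_ifs; exacts [h₀, zero_mem_Fset hpq])]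
      simp [Ne.symm h]

lemma foldF_pair {l : List ι} {a : ι → ℝ} {i₁ i₂ : ι} (hne : i₁ ≠ i₂) (hl : l.Nodup)
    (h₁ : a i₁ ∈ Fset p q) (h₂ : a i₂ ∈ Fset p q) (ha : ∀ i, i ≠ i₁ → i ≠ i₂ → a i = 0)
    (hsum : |a i₁ + a i₂| < thr p q) :
    foldF p q (l.map a) =
      .fin (rndR p q ((if i₁ ∈ l then a i₁ else 0) + (if i₂ ∈ l then a i₂ else 0))) := by
  have h0 := zero_mem_Fset hpq
  induction l using List.reverseRecOn with
  | nil => simp [foldF, rndR_of_mem hpq h0]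
  | append_singleton l i ih =>
    have hi : i ∉ l := by
      have := List.nodup_append.1 hl
      intro h; exact this.2.2 i h i (by simp) rfl
    rw [List.map_append, List.map_singleton, foldF_append_singleton,
      ih (List.nodup_append.1 hl).1]
    by_cases hi₁ : i = i₁
    · subst hi₁
      by_cases hm : i₂ ∈ l
      · simp [hi, hm, rndR_of_mem hpq h₂, fadd_fin (x := a i₂) (y := a i) (by rwa [add_comm]),
          add_comm]
      · simp [hi, hm, rndR_of_mem hpq h0, zero_fadd hpq h₁, hne.symm, rndR_of_mem hpq h₁]
    by_cases hi₂ : i = i₂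
    · subst hi₂
      by_cases hm : i₁ ∈ l
      · simp [hi, hm, rndR_of_mem hpq h₁, fadd_fin hsum]
      · simp [hi, hm, rndR_of_mem hpq h0, zero_fadd hpq h₂, hne, rndR_of_mem hpq h₂]
    rw [ha i hi₁ hi₂, fadd_zero hpq (rndR_mem hpq _)]
    simp [Ne.symm hi₁, Ne.symm hi₂]

/-- A sum of terms `0` and `-1` is finite, nonpositive, and vanishes only if all terms do. -/
lemma foldF_nonpos {l : List ι} {a : ι → ℝ} (ha : ∀ i, a i = 0 ∨ a i = -1) :
    ∃ s ∈ Fset p q, foldF p q (l.map a) = .fin s ∧ s ≤ 0 ∧ ((∀ i ∈ l, a i = 0) → s = 0) ∧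
      ((∃ i ∈ l, a i = -1) → s ≤ -1) := by
  have h0 := zero_mem_Fset hpq
  have h1 := neg_mem_Fset (one_mem_Fset hpq)
  induction l using List.reverseRecOn with
  | nil => exact ⟨0, h0, by simp [foldF]⟩
  | append_singleton l i ih =>
    obtain ⟨s, hs, hfold, hs0, hz, hn⟩ := ih
    rw [List.map_append, List.map_singleton, foldF_append_singleton, hfold]
    rcases ha i with hi | hi
    · refine ⟨s, hs, by rw [hi, fadd_zero hpq hs], hs0, fun h => hz fun j hj => h j (by simp [hj]),
        ?_⟩
      rintro ⟨j, hj, hj1⟩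
      rcases List.mem_append.1 hj with h | h
      · exact hn ⟨j, h, hj1⟩
      · rw [List.mem_singleton.1 h, hi] at hj1; norm_num at hj1
    · have hle : rndR p q (s + -1) ≤ -1 := rndR_le hpq h1 (by linarith)
      refine ⟨rndR p q (s + -1), rndR_mem hpq _, ?_, by linarith, fun h => ?_, fun _ => hle⟩
      · rw [hi, fadd_fin (abs_add_lt_thr hpq hs (by norm_num))]
      · have := h i (by simp)
        rw [hi] at this; norm_num at this

lemma sumTo_single {L : List ι} {a : ι → ℝ} {i₀ : ι} (hL : L.Nodup) (hL' : ∀ i, i ∈ L)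
    (h₀ : a i₀ ∈ Fset p q) (ha : ∀ i, i ≠ i₀ → a i = 0) : SumTo p q L a (a i₀) := by
  refine ⟨fun k => ⟨_, ?_, foldF_single hpq (hL.sublist (List.take_sublist k L)) h₀ ha⟩, ?_⟩
  · split_ifs
    exacts [h₀, zero_mem_Fset hpq]
  · rw [foldF_single hpq hL h₀ ha, if_pos (hL' _)]

lemma sumTo_pair {L : List ι} {a : ι → ℝ} {i₁ i₂ : ι} (hL : L.Nodup) (hL' : ∀ i, i ∈ L)
    (hne : i₁ ≠ i₂) (h₁ : a i₁ ∈ Fset p q) (h₂ : a i₂ ∈ Fset p q)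
    (ha : ∀ i, i ≠ i₁ → i ≠ i₂ → a i = 0) (hsum : |a i₁ + a i₂| < thr p q) :
    SumTo p q L a (rndR p q (a i₁ + a i₂)) := by
  refine ⟨fun k => ⟨_, rndR_mem hpq _,
    foldF_pair hpq hne (hL.sublist (List.take_sublist k L)) h₁ h₂ ha hsum⟩, ?_⟩
  rw [foldF_pair hpq hne hL h₁ h₂ ha hsum, if_pos (hL' _), if_pos (hL' _)]

lemma sumTo_zero (L : List ι) : SumTo p q L (fun _ => 0) 0 := by
  have h : ∀ l : List ι, foldF p q (l.map fun _ => 0) = .fin 0 := by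
    intro l
    induction l using List.reverseRecOn with
    | nil => rfl
    | append_singleton l i ih =>
      rw [List.map_append, List.map_singleton, foldF_append_singleton, ih,
        fadd_zero hpq (zero_mem_Fset hpq)]
  exact ⟨fun k => ⟨0, zero_mem_Fset hpq, h _⟩, h L⟩

lemma sumTo_nonpos {L : List ι} {a : ι → ℝ} (hL' : ∀ i, i ∈ L) (ha : ∀ i, a i = 0 ∨ a i = -1) :
    ∃ s ∈ Fset p q, SumTo p q L a s ∧ ((∀ i, a i = 0) → s = 0) ∧
      ((∃ i, a i = -1) → s ≤ -1) := by
  obtain ⟨s, hs, hf, -, hz, hn⟩ := foldF_nonpos hpq (l := L) ha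
  refine ⟨s, hs, ⟨fun k => ?_, hf⟩, fun h => hz fun i _ => h i, fun ⟨i, hi⟩ => hn ⟨i, hL' i, hi⟩⟩
  obtain ⟨s, hs, hf, -⟩ := foldF_nonpos hpq (l := L.take k) ha
  exact ⟨s, hs, hf⟩

end sums

/-- The dot product of the row `w` with `g`, taken along `L`, is `b`, and no product or partial
sum overflows. -/
def DotTo (p q : ℕ) {ι : Type*} (L : List ι) (w g : ι → ℝ) (b : ℝ) : Prop :=
  (∀ j, |w j * g j| < thr p q) ∧ SumTo p q L (fun j => rndR p q (w j * g j)) b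

section rows

variable {p q : ℕ} (hpq : Admissible p q) {ι : Type*}
include hpq

lemma thr_pos : 0 < thr p q := by
  simpa using abs_lt_thr_of_le hpq (zero_mem_Fset hpq) le_rfl

lemma dotTo_zero (L : List ι) {w g : ι → ℝ} (hw : ∀ j, w j = 0) : DotTo p q L w g 0 := by
  refine ⟨fun j => by simpa [hw] using thr_pos hpq, ?_⟩
  simpa [hw, rndR_of_mem hpq (zero_mem_Fset hpq)] using sumTo_zero hpq L

lemma dotTo_single {L : List ι} {w g : ι → ℝ} {j₀ : ι} (hL : L.Nodup) (hL' : ∀ i, i ∈ L)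
    (hw : ∀ j, j ≠ j₀ → w j = 0) (h₀ : |w j₀ * g j₀| < thr p q) :
    DotTo p q L w g (rndR p q (w j₀ * g j₀)) := by
  refine ⟨fun j => ?_, sumTo_single hpq hL hL' (rndR_mem hpq _) fun i hi => ?_⟩
  · by_cases h : j = j₀
    · rwa [h]
    · simpa [hw j h] using thr_pos hpq
  · simp [hw i hi, rndR_of_mem hpq (zero_mem_Fset hpq)]

lemma dotTo_pair {L : List ι} {w g : ι → ℝ} {j₁ j₂ : ι} (hL : L.Nodup) (hL' : ∀ i, i ∈ L)
    (hne : j₁ ≠ j₂) (hw : ∀ j, j ≠ j₁ → j ≠ j₂ → w j = 0) (h₁ : |w j₁ * g j₁| < thr p q)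
    (h₂ : |w j₂ * g j₂| < thr p q)
    (hsum : |rndR p q (w j₁ * g j₁) + rndR p q (w j₂ * g j₂)| < thr p q) :
    DotTo p q L w g (rndR p q (rndR p q (w j₁ * g j₁) + rndR p q (w j₂ * g j₂))) := by
  refine ⟨fun j => ?_, sumTo_pair hpq hL hL' hne (rndR_mem hpq _) (rndR_mem hpq _)
    (fun i hi hi' => ?_) hsum⟩
  · by_cases h : j = j₁
    · rwa [h]
    by_cases h' : j = j₂
    · rwa [h']
    simpa [hw j h h'] using thr_pos hpq
  · simp [hw i hi hi', rndR_of_mem hpq (zero_mem_Fset hpq)]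

/-- Evaluation of an affine layer whose neurons are indexed by arbitrary types. -/
lemma affine_layer {κ : Type*} {n m : ℕ} (e : Fin n ≃ ι) (f : Fin m ≃ κ) {W : κ → ι → ℝ} {c : ℝ}
    {g : ι → ℝ} {b : κ → ℝ} {v : Fin n → EF} (hv : ∀ j, v j = .fin (g (e j)))
    (hdot : ∀ i, DotTo p q ((List.finRange n).map e) (W i) g (b i))
    (hc : ∀ i, |b i + c| < thr p q) :
    AffIntermFin p q (fun i j => W (f i) (e j)) c v ∧
      ∀ i, affApply p q (fun i j => W (f i) (e j)) c v i = .fin (rndR p q (b (f i) + c)) := by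
  have hsum : ∀ i (l : List (Fin n)),
      fsuml p q (l.map fun j => fmul p q (.fin (W (f i) (e j))) (v j)) =
        foldF p q ((l.map e).map fun j => rndR p q (W (f i) j * g j)) := by
    intro i l
    rw [← fsuml_map_fin hpq (by simp only [List.mem_map]; rintro x ⟨j, -, rfl⟩; exact rndR_mem hpq _)]
    simp only [List.map_map]
    congr 1
    refine List.map_congr_left fun j _ => ?_
    simp only [Function.comp]
    rw [hv, fmul_fin ((hdot (f i)).1 _)]
  have happ : ∀ i, affApply p q (fun i j => W (f i) (e j)) c v i =
      .fin (rndR p q (b (f i) + c)) := by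
    intro i
    unfold affApply fsum
    rw [hsum i, (hdot (f i)).2.2, fadd_fin (hc _)]
  refine ⟨fun i => ⟨fun k => ?_, ?_⟩, happ⟩
  · obtain ⟨s, -, hs⟩ := (hdot (f i)).2.1 k
    rw [hsum i, List.map_take, hs]
    trivial
  · rw [happ]
    trivial

/-- Evaluation of an affine layer followed by the rounded ReLU. -/
lemma relu_layer {κ : Type*} {n m : ℕ} (e : Fin n ≃ ι) (f : Fin m ≃ κ) {W : κ → ι → ℝ} {c : ℝ}
    {g : ι → ℝ} {b h : κ → ℝ} {v : Fin n → EF} (hv : ∀ j, v j = .fin (g (e j)))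
    (hdot : ∀ i, DotTo p q ((List.finRange n).map e) (W i) g (b i))
    (hc : ∀ i, |b i + c| < thr p q) (hh : ∀ i, max (rndR p q (b i + c)) 0 = h i) :
    AffIntermFin p q (fun i j => W (f i) (e j)) c v ∧
      ∀ i, frelu p q (affApply p q (fun i j => W (f i) (e j)) c v i) = .fin (h (f i)) := by
  obtain ⟨h₁, h₂⟩ := affine_layer hpq e f hv hdot hc
  exact ⟨h₁, fun i => by rw [h₂, frelu_fin hpq (rndR_mem hpq _), hh]⟩

end rows

end FPT

namespace FPT

/-! ### Threshold literals -/

/-- The bias of the first layer. -/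
noncomputable def bias₁ (q : ℕ) : ℝ := 2 ^ (emin q + 1)

/-- The bias of the third layer. -/
noncomputable def bias₃ (p : ℕ) : ℝ := 2 ^ (1 - (p : ℤ))

/-- The parameters `(w, v, α)` of a threshold test on a single coordinate. -/
def testSet (p q : ℕ) : Set (ℝ × ℝ × ℝ) :=
  {l | l ∈ Fset p q ×ˢ Fset p q ×ˢ Fset p q ∧ |l.1| ≤ 1 ∧ 0 ≤ l.2.1 ∧ l.2.1 ≤ 1 ∧
    0 ≤ l.2.2 ∧ l.2.2 * bias₁ q ≤ 1}

lemma testSet_finite (p q : ℕ) : (testSet p q).Finite :=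
  ((Fset_finite p q).prod ((Fset_finite p q).prod (Fset_finite p q))).subset fun _ h => h.1

/-- The first-layer neuron with weight `w`. -/
noncomputable def probe (p q : ℕ) (w x : ℝ) : ℝ :=
  max (rndR p q (rndR p q (w * x) + bias₁ q)) 0

/-- The difference between the constant of the test `l` and its scaled probe. -/
noncomputable def margin (p q : ℕ) (l : ℝ × ℝ × ℝ) (x : ℝ) : ℝ :=
  rndR p q (l.2.2 * bias₁ q) + rndR p q (-l.2.1 * probe p q l.1 x)

/-- The second-layer neuron of the test `l`. -/
noncomputable def excess (p q : ℕ) (l : ℝ × ℝ × ℝ) (x : ℝ) : ℝ :=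
  max (rndR p q (margin p q l x)) 0

/-- The fourth-layer indicator of the test `l` (or of its negation). -/
noncomputable def literal (p q : ℕ) (l : ℝ × ℝ × ℝ) (β : Bool) (x : ℝ) : ℝ :=
  if (margin p q l x ≤ 0 ↔ β = false) then 1 else 0

section literals

variable {p q : ℕ} (hpq : Admissible p q)
include hpq

lemma bias₁_mem : bias₁ q ∈ Fset p q := by
  have h1 := hpq.emin_le
  have h2 := emax_eq q
  exact zpow_mem_Fset (by omega) (by omega) hpq

omit hpq in
lemma bias₁_pos : 0 < bias₁ q := by unfold bias₁; positivity

lemma bias₁_le : bias₁ q ≤ 2 ^ (-(p : ℤ)) :=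
  zpow_le_zpow_right₀ (by norm_num) (by have := hpq.emin_le; omega)

lemma bias₁_le_one : bias₁ q ≤ 1 :=
  zpow_le_one_of_nonpos₀ (by norm_num) (by have := hpq.emin_le; omega)

lemma bias₃_mem : bias₃ p ∈ Fset p q := by
  have h1 := hpq.emin_le
  have h2 := emax_eq q
  exact zpow_mem_Fset (by omega) (by omega) hpq

omit hpq in
lemma bias₃_pos : 0 < bias₃ p := by unfold bias₃; positivity

lemma bias₃_le_one : bias₃ p ≤ 1 :=
  zpow_le_one_of_nonpos₀ (by norm_num) (by have := hpq.two_le; omega)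

omit hpq in
lemma probe_nonneg (w x : ℝ) : 0 ≤ probe p q w x := le_max_right _ _

lemma probe_mem (w x : ℝ) : probe p q w x ∈ Fset p q := max_zero_mem hpq (rndR_mem hpq _)

lemma rndR_neg_mul_probe_nonpos {l : ℝ × ℝ × ℝ} (hl : l ∈ testSet p q) (x : ℝ) :
    rndR p q (-l.2.1 * probe p q l.1 x) ≤ 0 := by
  obtain ⟨-, -, h1, -⟩ := hl
  refine rndR_le hpq (zero_mem_Fset hpq) ?_
  have := mul_nonneg h1 (probe_nonneg (p := p) (q := q) l.1 x)
  linarith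

lemma abs_const_le {l : ℝ × ℝ × ℝ} (hl : l ∈ testSet p q) :
    |rndR p q (l.2.2 * bias₁ q)| ≤ 1 := by
  obtain ⟨-, -, -, -, h1, h2⟩ := hl
  rw [abs_le]
  refine ⟨?_, rndR_le hpq (one_mem_Fset hpq) h2⟩
  have := le_rndR hpq (zero_mem_Fset hpq) (mul_nonneg h1 (bias₁_pos (q := q)).le)
  linarith

lemma excess_of_nonpos {l : ℝ × ℝ × ℝ} {x : ℝ} (h : margin p q l x ≤ 0) :
    excess p q l x = 0 := max_eq_right (rndR_le hpq (zero_mem_Fset hpq) h)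

lemma le_excess_of_pos {l : ℝ × ℝ × ℝ} {x : ℝ} (h : 0 < margin p q l x) :
    (2 : ℝ) ^ (emin q - (p : ℤ)) ≤ excess p q l x := by
  refine le_max_of_le_left (le_rndR hpq ?_ ?_)
  · have h1 := hpq.emin_le
    have h2 := emax_eq q
    exact zpow_mem_Fset le_rfl (by omega) hpq
  · obtain ⟨n, hn⟩ := exists_eq_mul_of_mem_Fset (rndR_mem hpq (l.2.2 * bias₁ q))
    obtain ⟨k, hk⟩ := exists_eq_mul_of_mem_Fset (rndR_mem hpq (-l.2.1 * probe p q l.1 x))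
    have hmar : margin p q l x = ((n + k : ℤ) : ℝ) * (2 : ℝ) ^ (emin q - (p : ℤ)) := by
      rw [margin, hn, hk]; push_cast; ring
    rw [hmar] at h ⊢
    have h2 : (0 : ℝ) < (2 : ℝ) ^ (emin q - (p : ℤ)) := by positivity
    have h3 : (0 : ℤ) < n + k := by exact_mod_cast pos_of_mul_pos_left h h2.le
    have h4 : (1 : ℝ) ≤ ((n + k : ℤ) : ℝ) := by exact_mod_cast h3
    nlinarith

lemma excess_le_one {l : ℝ × ℝ × ℝ} (hl : l ∈ testSet p q) (x : ℝ) : excess p q l x ≤ 1 := by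
  refine max_le (rndR_le hpq (one_mem_Fset hpq) ?_) zero_le_one
  have h1 := (abs_le.1 (abs_const_le hpq hl)).2
  have h2 := rndR_neg_mul_probe_nonpos hpq hl x
  unfold margin
  linarith

/-- A test separating all points `≤ y` from all points `≥ z`, for small `y`. -/
lemma exists_test_of_lt_four {y z : ℝ} (hy : y ∈ Fset p q) (hz : z ∈ Fset p q) (hy0 : 0 ≤ y)
    (hyz : y < z) (hy4 : y < 4) :
    ∃ l ∈ testSet p q, (∀ x ≤ y, margin p q l x ≤ 0) ∧ ∀ x, z ≤ x → 0 < margin p q l x := by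
  have hemin := hpq.emin_le
  have hemax := emax_eq q
  have hp2 := hpq.two_le
  obtain ⟨m, e, h1, h2, h3, h4, rfl⟩ := id hy
  have hpos : (0 : ℝ) < (2 : ℝ) ^ (e - (p : ℤ)) := by positivity
  have hm0 : 0 ≤ m := by exact_mod_cast nonneg_of_mul_nonneg_left hy0 hpos
  have hgap := succ_mul_zpow_le hm0 h4 hz hyz
  rw [abs_of_nonneg hm0] at h1 h4
  have he1 : e ≤ 1 := by
    rcases h4 with h4 | h4
    · by_contra! he
      have h5 : (2 : ℝ) ^ (2 : ℤ) ≤ (2 : ℝ) ^ e := zpow_le_zpow_right₀ (by norm_num) (by omega)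
      have h6 : (2 : ℝ) ^ p * (2 : ℝ) ^ (e - (p : ℤ)) ≤ m * (2 : ℝ) ^ (e - (p : ℤ)) := by
        gcongr; exact_mod_cast h4
      rw [← zpow_natCast, ← zpow_add₀ two_ne_zero, add_sub_cancel] at h6
      norm_num at h5
      linarith
    · omega
  set η : ℝ := (2 : ℝ) ^ (emin q - (p : ℤ)) with hη
  have hη0 : 0 < η := by positivity
  have hb : bias₁ q = 2 ^ (p + 1) * η := by
    rw [hη, bias₁, ← zpow_natCast, ← zpow_add₀ two_ne_zero]; congr 1; push_cast; ring
  have hscale : (2 : ℝ) ^ (emin q - e) * (2 : ℝ) ^ (e - (p : ℤ)) = η := by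
    rw [← zpow_add₀ two_ne_zero]; congr 1; ring
  have hw0 : (0 : ℝ) < (2 : ℝ) ^ (emin q - e) := by positivity
  have hmul : ∀ k : ℤ, |k| ≤ 2 ^ (p + 1) → (k : ℝ) * η ∈ Fset p q :=
    fun k hk => mem_Fset hk le_rfl (by omega)
  set n : ℤ := 2 ^ (p + 1) - m with hn
  have hn1 : 1 ≤ n := by omega
  have hn2 : n ≤ 2 ^ (p + 1) := by omega
  have hnR : (n : ℝ) = 2 ^ (p + 1) - m := by rw [hn]; push_cast; ring
  have hα : (n : ℝ) * (2 : ℝ) ^ (-(p : ℤ) - 1) * bias₁ q = n * η := by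
    rw [bias₁, hη, mul_assoc, ← zpow_add₀ two_ne_zero]; congr 2; ring
  have hnη : (n : ℝ) * η ∈ Fset p q := hmul n (by rw [abs_of_nonneg (by omega)]; exact hn2)
  have hnηle : (n : ℝ) * η ≤ bias₁ q := by
    rw [hb]; gcongr; exact_mod_cast hn2
  have hn0 : (0 : ℝ) ≤ n := by exact_mod_cast (by omega : 0 ≤ n)
  refine ⟨(-(2 : ℝ) ^ (emin q - e), 1, (n : ℝ) * (2 : ℝ) ^ (-(p : ℤ) - 1)),
    ⟨⟨neg_mem_Fset (zpow_mem_Fset (by omega) (by omega) hpq), one_mem_Fset hpq,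
      mem_Fset (by rw [abs_of_nonneg (by omega)]; exact hn2) (by omega) (by omega)⟩,
      ?_, zero_le_one, le_rfl, by positivity, ?_⟩, ?_, ?_⟩
  · rw [abs_neg, abs_of_pos hw0]
    exact zpow_le_one_of_nonpos₀ (by norm_num) (by omega)
  · dsimp only
    rw [hα]; exact hnηle.trans (bias₁_le_one hpq)
  · intro x hx
    simp only [margin]
    rw [hα, rndR_of_mem hpq hnη]
    have hm' : (-(m : ℤ) : ℝ) * η ∈ Fset p q := by
      have := hmul (-m) (by rw [abs_neg, abs_of_nonneg hm0]; omega)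
      push_cast at this; exact this
    have s1 : (-(m : ℤ) : ℝ) * η ≤ rndR p q (-(2 : ℝ) ^ (emin q - e) * x) := by
      refine le_rndR hpq hm' ?_
      have := mul_le_mul_of_nonneg_left hx hw0.le
      rw [← hscale]; linarith
    have s2 : (n : ℝ) * η ≤ probe p q (-(2 : ℝ) ^ (emin q - e)) x := by
      refine le_max_of_le_left (le_rndR hpq hnη ?_)
      rw [hb, hnR]; linarith
    have s3 : rndR p q (-1 * probe p q (-(2 : ℝ) ^ (emin q - e)) x) ≤ -(n * η) :=
      rndR_le hpq (neg_mem_Fset hnη) (by linarith)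
    linarith
  · intro x hx
    simp only [margin]
    rw [hα, rndR_of_mem hpq hnη]
    have hm' : (-((m : ℝ) + 1)) * η ∈ Fset p q := by
      have := hmul (-(m + 1)) (by rw [abs_neg, abs_of_nonneg (by omega)]; omega)
      push_cast at this; exact_mod_cast this
    have hn' : ((n : ℝ) - 1) * η ∈ Fset p q := by
      have := hmul (n - 1) (by rw [abs_of_nonneg (by omega)]; omega)
      push_cast at this; exact this
    have s1 : rndR p q (-(2 : ℝ) ^ (emin q - e) * x) ≤ (-((m : ℝ) + 1)) * η := by
      refine rndR_le hpq hm' ?_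
      have := mul_le_mul_of_nonneg_left (hgap.trans hx) hw0.le
      rw [← hscale]; linarith
    have s2 : probe p q (-(2 : ℝ) ^ (emin q - e)) x ≤ ((n : ℝ) - 1) * η := by
      refine max_le (rndR_le hpq hn' ?_) (mul_nonneg ?_ hη0.le)
      · rw [hb, hnR]; linarith
      · have : (1 : ℝ) ≤ n := by exact_mod_cast hn1
        linarith
    have s3 : -(((n : ℝ) - 1) * η) ≤ rndR p q (-1 * probe p q (-(2 : ℝ) ^ (emin q - e)) x) :=
      le_rndR hpq (neg_mem_Fset hn') (by linarith)
    linarith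

/-- A test separating all points `≤ y` from all points `≥ z`, for large `y`. -/
lemma exists_test_of_four_le {y z : ℝ} (hy : y ∈ Fset p q) (hz : z ∈ Fset p q)
    (hyz : y < z) (hy4 : 4 ≤ y) :
    ∃ l ∈ testSet p q, (∀ x ≤ y, 0 < margin p q l x) ∧ ∀ x, z ≤ x → margin p q l x ≤ 0 := by
  have hemin := hpq.emin_le
  have hemax := emax_eq q
  have hp2 := hpq.two_le
  obtain ⟨m, e, h1, h2, h3, h4, rfl⟩ := id hy
  have hpos : (0 : ℝ) < (2 : ℝ) ^ (e - (p : ℤ)) := by positivity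
  have hm0 : 0 ≤ m := by exact_mod_cast nonneg_of_mul_nonneg_left (le_trans (by norm_num) hy4) hpos
  have hgap := succ_mul_zpow_le hm0 h4 hz hyz
  rw [abs_of_nonneg hm0] at h1 h4
  have he2 : 2 ≤ e := by
    by_contra! he
    have h5 : (2 : ℝ) ^ (e + 1) ≤ (2 : ℝ) ^ (2 : ℤ) :=
      zpow_le_zpow_right₀ (by norm_num) (by omega)
    have h6 : m * (2 : ℝ) ^ (e - (p : ℤ)) < (2 : ℝ) ^ (p + 1) * (2 : ℝ) ^ (e - (p : ℤ)) := by
      gcongr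
      have : m < 2 ^ (p + 1) := by omega
      exact_mod_cast this
    rw [← zpow_natCast, ← zpow_add₀ two_ne_zero] at h6
    rw [show ((p + 1 : ℕ) : ℤ) + (e - p) = e + 1 by push_cast; ring] at h6
    norm_num at h5
    linarith
  have hmp : (2 : ℤ) ^ p ≤ m := by
    rcases h4 with h4 | h4
    · exact h4
    · omega
  have hscale : (2 : ℝ) ^ (2 - e) * (2 : ℝ) ^ (e - (p : ℤ)) = (2 : ℝ) ^ (2 - (p : ℤ)) := by
    rw [← zpow_add₀ two_ne_zero]; congr 1; ring
  have hw0 : (0 : ℝ) < (2 : ℝ) ^ (2 - e) := by positivity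
  set δ : ℝ := (2 : ℝ) ^ (2 - (p : ℤ)) with hδ
  have hδ0 : 0 < δ := by positivity
  have hδb : 4 * bias₁ q ≤ δ := by
    have := bias₁_le hpq
    have h5 : δ = 4 * (2 : ℝ) ^ (-(p : ℤ)) := by
      rw [hδ, sub_eq_add_neg, zpow_add₀ two_ne_zero]; norm_num
    linarith
  have hb0 := bias₁_pos (q := q)
  set δ' : ℝ := (2 : ℝ) ^ (-(p : ℤ) - 1) with hδ'
  have hδδ' : δ = 8 * δ' := by
    rw [hδ, hδ', show 2 - (p : ℤ) = 3 + (-(p : ℤ) - 1) by ring, zpow_add₀ two_ne_zero]; norm_num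
  have hm : |m| ≤ 2 ^ (p + 1) := by rw [abs_of_nonneg hm0]; omega
  have hm1 : |m + 1| ≤ 2 ^ (p + 1) := by rw [abs_of_nonneg (by omega)]; omega
  have hmul : ∀ k : ℤ, |k| ≤ 2 ^ (p + 1) → (k : ℝ) * δ ∈ Fset p q :=
    fun k hk => mem_Fset hk (by omega) (by omega)
  have hmul' : ∀ k : ℤ, |k| ≤ 2 ^ (p + 1) → (k : ℝ) * δ' ∈ Fset p q :=
    fun k hk => mem_Fset hk (by omega) (by omega)
  have hα : ((m + 1 : ℤ) : ℝ) * (2 : ℝ) ^ (-(p : ℤ) - 2 - emin q) * bias₁ q =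
      ((m + 1 : ℤ) : ℝ) * δ' := by
    rw [bias₁, hδ', mul_assoc, ← zpow_add₀ two_ne_zero]; congr 2; ring
  have hv : (2 : ℝ) ^ (-3 : ℤ) = 1 / 8 := by norm_num
  have hm1R : (0 : ℝ) ≤ ((m + 1 : ℤ) : ℝ) := by exact_mod_cast (by omega : 0 ≤ m + 1)
  have hmR : (0 : ℝ) ≤ (m : ℝ) := by exact_mod_cast hm0
  refine ⟨((2 : ℝ) ^ (2 - e), 1 / 8, ((m + 1 : ℤ) : ℝ) * (2 : ℝ) ^ (-(p : ℤ) - 2 - emin q)),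
    ⟨⟨zpow_mem_Fset (by omega) (by omega) hpq, hv ▸ zpow_mem_Fset (by omega) (by omega) hpq,
      mem_Fset hm1 (by omega) (by omega)⟩,
      ?_, by norm_num, by norm_num, by positivity, ?_⟩, ?_, ?_⟩
  · rw [abs_of_pos hw0]
    exact zpow_le_one_of_nonpos₀ (by norm_num) (by omega)
  · dsimp only
    rw [hα]
    have h5 : ((m + 1 : ℤ) : ℝ) ≤ 2 ^ (p + 1) := by exact_mod_cast (by omega : m + 1 ≤ 2 ^ (p + 1))
    have h6 : (2 : ℝ) ^ (p + 1) * δ' = 1 := by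
      rw [hδ', ← zpow_natCast, ← zpow_add₀ two_ne_zero]
      rw [show ((p + 1 : ℕ) : ℤ) + (-p - 1) = 0 by push_cast; ring, zpow_zero]
    rw [← h6]
    gcongr
  · intro x hx
    simp only [margin]
    rw [hα, rndR_of_mem hpq (hmul' _ hm1)]
    have s1 : rndR p q ((2 : ℝ) ^ (2 - e) * x) ≤ m * δ := by
      refine rndR_le hpq (hmul m hm) ?_
      have := mul_le_mul_of_nonneg_left hx hw0.le
      rw [← hscale]; linarith
    have s2 : rndR p q (m * δ + bias₁ q) ≤ m * δ := by
      by_contra! hlt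
      have h5 := succ_mul_zpow_le (e := 2) hm0 (Or.inl (by rwa [abs_of_nonneg hm0]))
        (rndR_mem hpq _) hlt
      have h6 := abs_sub_rndR_le hpq (m * δ + bias₁ q) (hmul m hm)
      rw [add_sub_cancel_left, abs_of_pos hb0] at h6
      have h7 := (abs_le.1 h6).1
      linarith
    have s3 : probe p q ((2 : ℝ) ^ (2 - e)) x ≤ m * δ :=
      max_le ((rndR_mono hpq (by linarith)).trans s2) (by positivity)
    have s4 : -(m * δ') ≤ rndR p q (-(1 / 8) * probe p q ((2 : ℝ) ^ (2 - e)) x) :=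
      le_rndR hpq (neg_mem_Fset (hmul' m hm)) (by rw [hδδ'] at s3; linarith)
    have h5 : 0 < δ' := by positivity
    push_cast
    linarith
  · intro x hx
    simp only [margin]
    rw [hα, rndR_of_mem hpq (hmul' _ hm1)]
    have s1 : ((m + 1 : ℤ) : ℝ) * δ ≤ rndR p q ((2 : ℝ) ^ (2 - e) * x) := by
      refine le_rndR hpq (hmul _ hm1) ?_
      have := mul_le_mul_of_nonneg_left (hgap.trans hx) hw0.le
      rw [← hscale]; push_cast; linarith
    have s2 : ((m + 1 : ℤ) : ℝ) * δ ≤ probe p q ((2 : ℝ) ^ (2 - e)) x :=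
      le_max_of_le_left (le_rndR hpq (hmul _ hm1) (by linarith))
    have s3 : rndR p q (-(1 / 8) * probe p q ((2 : ℝ) ^ (2 - e)) x) ≤ -(((m + 1 : ℤ) : ℝ) * δ') :=
      rndR_le hpq (neg_mem_Fset (hmul' _ hm1)) (by rw [hδδ'] at s2; linarith)
    linarith

lemma exists_test_of_lt {x z : ℝ} (hx : x ∈ Fset p q) (hz : z ∈ Fset p q) (hxz : x < z) :
    ∃ l ∈ testSet p q, ¬(margin p q l x ≤ 0 ↔ margin p q l z ≤ 0) := by
  have key : ∀ y z : ℝ, y ∈ Fset p q → z ∈ Fset p q → 0 ≤ y → y < z →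
      ∃ l ∈ testSet p q, ∀ u v, u ≤ y → z ≤ v → ¬(margin p q l u ≤ 0 ↔ margin p q l v ≤ 0) := by
    intro y z hy hz hy0 hyz
    rcases lt_or_ge y 4 with h | h
    · obtain ⟨l, hl, h1, h2⟩ := exists_test_of_lt_four hpq hy hz hy0 hyz h
      exact ⟨l, hl, fun u v hu hv hiff => absurd (hiff.1 (h1 u hu)) (not_le.2 (h2 v hv))⟩
    · obtain ⟨l, hl, h1, h2⟩ := exists_test_of_four_le hpq hy hz hyz h
      exact ⟨l, hl, fun u v hu hv hiff => absurd (hiff.2 (h2 v hv)) (not_le.2 (h1 u hu))⟩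
  have hneg : ∀ l : ℝ × ℝ × ℝ, ∀ u, margin p q (-l.1, l.2) u = margin p q l (-u) := by
    intro l u
    simp only [margin, probe, neg_mul, mul_neg]
  rcases lt_or_ge 0 z with hz0 | hz0
  · obtain ⟨l, hl, h⟩ := key (max x 0) z (max_zero_mem hpq hx) hz (le_max_right _ _)
      (max_lt hxz hz0)
    exact ⟨l, hl, h x z (le_max_left _ _) le_rfl⟩
  · obtain ⟨l, hl, h⟩ := key (-z) (-x) (neg_mem_Fset hz) (neg_mem_Fset hx) (by linarith)
      (by linarith)
    refine ⟨(-l.1, l.2), ⟨⟨neg_mem_Fset hl.1.1, hl.1.2⟩, by simpa using hl.2.1, hl.2.2⟩, ?_⟩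
    rw [hneg, hneg]
    exact fun hiff => h _ _ le_rfl le_rfl hiff.symm

/-- Distinct floats are told apart by a literal. -/
lemma exists_literal {x z : ℝ} (hx : x ∈ Fset p q) (hz : z ∈ Fset p q) (hxz : x ≠ z) :
    ∃ l ∈ testSet p q, ∃ β, literal p q l β z = 0 ∧ literal p q l β x = 1 := by
  obtain ⟨l, hl, h⟩ : ∃ l ∈ testSet p q, ¬(margin p q l x ≤ 0 ↔ margin p q l z ≤ 0) := by
    rcases lt_or_gt_of_ne hxz with h | h
    · exact exists_test_of_lt hpq hx hz h
    · obtain ⟨l, hl, h⟩ := exists_test_of_lt hpq hz hx h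
      exact ⟨l, hl, fun h' => h h'.symm⟩
  refine ⟨l, hl, !decide (margin p q l x ≤ 0), ?_⟩
  by_cases h1 : margin p q l x ≤ 0 <;> by_cases h2 : margin p q l z ≤ 0 <;>
    simp_all [literal]

end literals

end FPT

namespace FPT

/-! ### The neurons of the network -/

section network

variable {p q : ℕ} (hpq : Admissible p q)
include hpq

/-- The largest power of two, used to amplify the second layer. -/
lemma zpow_emax_mem : (2 : ℝ) ^ emax q ∈ Fset p q := by
  have h1 := hpq.emin_le
  have h2 := emax_eq q
  exact zpow_mem_Fset (by omega) le_rfl hpq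

lemma zpow_pred_mem : (2 : ℝ) ^ ((p : ℤ) - 1) ∈ Fset p q := by
  have h1 := hpq.emin_le
  have h2 := emax_eq q
  exact zpow_mem_Fset (by omega) (by omega) hpq

omit hpq in
lemma zpow_pred_mul_bias₃ : (2 : ℝ) ^ ((p : ℤ) - 1) * bias₃ p = 1 := by
  rw [bias₃, ← zpow_add₀ two_ne_zero]; norm_num

lemma abs_mul_lt_thr {x y : ℝ} (hx : |x| ≤ 1) (hy : y ∈ Fset p q) : |x * y| < thr p q := by
  refine abs_lt_thr_of_le hpq hy ?_
  rw [abs_mul]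
  exact mul_le_of_le_one_left (abs_nonneg _) hx

/-- The third-layer neuron of a test. -/
lemma relu_amplified_excess {l : ℝ × ℝ × ℝ} (hl : l ∈ testSet p q) (x : ℝ) :
    |-(2 : ℝ) ^ emax q * excess p q l x| < thr p q ∧
      max (rndR p q (rndR p q (-(2 : ℝ) ^ emax q * excess p q l x) + bias₃ p)) 0 =
        if margin p q l x ≤ 0 then bias₃ p else 0 := by
  have h0 : 0 ≤ excess p q l x := le_max_right _ _
  have h1 := excess_le_one hpq hl x
  refine ⟨?_, ?_⟩
  · rw [mul_comm, ← neg_mul_comm]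
    refine abs_mul_lt_thr hpq ?_ (zpow_emax_mem hpq)
    rw [abs_neg, abs_of_nonneg h0]
    exact h1
  · split_ifs with h
    · rw [excess_of_nonpos hpq h, mul_zero, rndR_of_mem hpq (zero_mem_Fset hpq), zero_add,
        rndR_of_mem hpq (bias₃_mem hpq), max_eq_left bias₃_pos.le]
    · have h2 := le_excess_of_pos hpq (not_le.1 h)
      have h3 : (2 : ℝ) ^ emax q * (2 : ℝ) ^ (emin q - (p : ℤ)) = bias₃ p := by
        rw [bias₃, emax_eq, ← zpow_add₀ two_ne_zero]; congr 1; ring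
      have h4 : rndR p q (-(2 : ℝ) ^ emax q * excess p q l x) ≤ -bias₃ p := by
        refine rndR_le hpq (neg_mem_Fset (bias₃_mem hpq)) ?_
        have h5 : (0 : ℝ) < (2 : ℝ) ^ emax q := by positivity
        have := mul_le_mul_of_nonneg_left h2 h5.le
        linarith
      exact max_eq_right (rndR_le hpq (zero_mem_Fset hpq) (by linarith))

lemma abs_margin_lt_thr {l : ℝ × ℝ × ℝ} (hl : l ∈ testSet p q) (x : ℝ) :
    |margin p q l x| < thr p q := by
  unfold margin
  rw [add_comm]
  exact abs_add_lt_thr hpq (rndR_mem hpq _) (abs_const_le hpq hl)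

omit hpq in
lemma literal_eq_zero_or_one (l : ℝ × ℝ × ℝ) (β : Bool) (x : ℝ) :
    literal p q l β x = 0 ∨ literal p q l β x = 1 := by
  unfold literal
  split_ifs <;> simp

end network

/-- Every finite function on floats is the output of a six-layer network without overflow. -/
theorem exists_six_layer_network {p q : ℕ} (hpq : Admissible p q) (d0 d6 : ℕ)
    (fstar : (Fin d0 → EF) → Fin d6 → EF)
    (hfs : ∀ x : Fin d0 → EF, VecFin p q x → VecFin p q (fstar x)) :
    ∃ (d1 d2 d3 d4 d5 : ℕ)
      (W1 : Fin d1 → Fin d0 → ℝ) (c1 : ℝ) (W2 : Fin d2 → Fin d1 → ℝ) (c2 : ℝ)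
      (W3 : Fin d3 → Fin d2 → ℝ) (c3 : ℝ) (W4 : Fin d4 → Fin d3 → ℝ) (c4 : ℝ)
      (W5 : Fin d5 → Fin d4 → ℝ) (c5 : ℝ) (W6 : Fin d6 → Fin d5 → ℝ) (c6 : ℝ),
      (∀ i j, W1 i j ∈ Fset p q) ∧ c1 ∈ Fset p q ∧
      (∀ i j, W2 i j ∈ Fset p q) ∧ c2 ∈ Fset p q ∧
      (∀ i j, W3 i j ∈ Fset p q) ∧ c3 ∈ Fset p q ∧
      (∀ i j, W4 i j ∈ Fset p q) ∧ c4 ∈ Fset p q ∧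
      (∀ i j, W5 i j ∈ Fset p q) ∧ c5 ∈ Fset p q ∧
      (∀ i j, W6 i j ∈ Fset p q) ∧ c6 ∈ Fset p q ∧
      ∀ x : Fin d0 → EF, VecFin p q x →
        let y1 := fun i => frelu p q (affApply p q W1 c1 x i)
        let y2 := fun i => frelu p q (affApply p q W2 c2 y1 i)
        let y3 := fun i => frelu p q (affApply p q W3 c3 y2 i)
        let y4 := fun i => frelu p q (affApply p q W4 c4 y3 i)
        let y5 := fun i => frelu p q (affApply p q W5 c5 y4 i)
        affApply p q W6 c6 y5 = fstar x ∧
        AffIntermFin p q W1 c1 x ∧ AffIntermFin p q W2 c2 y1 ∧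
        AffIntermFin p q W3 c3 y2 ∧ AffIntermFin p q W4 c4 y3 ∧
        AffIntermFin p q W5 c5 y4 ∧ AffIntermFin p q W6 c6 y5 := by
  have h0 := zero_mem_Fset hpq
  have h1 := one_mem_Fset hpq
  have hK := zpow_pred_mem hpq
  have hb₁ := bias₁_mem hpq
  have hb₃ := bias₃_mem hpq
  have := (Fset_finite p q).to_subtype
  have := (testSet_finite p q).to_subtype
  have := Fintype.ofFinite (Fset p q)
  have := Fintype.ofFinite (testSet p q)
  let N := Fin d0 × testSet p q
  have hval : ∀ z : Fin d0 → Fset p q, ∀ i, ∃ r ∈ Fset p q,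
      fstar (fun j => .fin (z j)) i = .fin r := by
    intro z i
    have h := hfs (fun j => .fin (z j)) (fun j => (z j).2) i
    generalize fstar (fun j => .fin (z j)) i = y at h
    cases y with
    | fin r => exact ⟨r, h, rfl⟩
    | pinf => exact h.elim
    | ninf => exact h.elim
    | nan => exact h.elim
  choose F hF hfF using hval
  let e1 := (Fintype.equivFin (Option N)).symm
  let e2 := (Fintype.equivFin N).symm
  let e4 := (Fintype.equivFin (N × Bool)).symm
  let e5 := (Fintype.equivFin (Fin d0 → Fset p q)).symm
  let V1 : Option N → Fin d0 → ℝ :=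
    fun i j => i.elim 0 fun u => if j = u.1 then u.2.1.1 else 0
  let V2 : N → Option N → ℝ :=
    fun u i => i.elim u.2.1.2.2 fun u' => if u' = u then -u.2.1.2.1 else 0
  let V3 : Option N → N → ℝ :=
    fun i u' => i.elim 0 fun u => if u' = u then -(2 : ℝ) ^ emax q else 0
  let V4 : N × Bool → Option N → ℝ := fun i j =>
    j.elim (if i.2 then (2 : ℝ) ^ ((p : ℤ) - 1) else 0) fun u' =>
      if u' = i.1 then (if i.2 then -(2 : ℝ) ^ ((p : ℤ) - 1) else (2 : ℝ) ^ ((p : ℤ) - 1)) else 0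
  let V5 : (Fin d0 → Fset p q) → N × Bool → ℝ := fun z i =>
    if literal p q i.1.2 i.2 (z i.1.1) = 0 then -1 else 0
  let V6 : Fin d6 → (Fin d0 → Fset p q) → ℝ := fun i z => F z i
  refine ⟨_, _, _, _, _, fun i j => V1 (e1 i) (Equiv.refl _ j), bias₁ q,
    fun i j => V2 (e2 i) (e1 j), 0, fun i j => V3 (e1 i) (e2 j), bias₃ p,
    fun i j => V4 (e4 i) (e1 j), 0, fun i j => V5 (e5 i) (e4 j), 1,
    fun i j => V6 (Equiv.refl _ i) (e5 j), 0, ?_, hb₁, ?_, h0, ?_, hb₃, ?_, h0, ?_, h1, ?_, h0, ?_⟩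
  · intro i j
    simp only [V1]
    cases e1 i with
    | none => exact h0
    | some u => simp only [Option.elim]; split_ifs; exacts [u.2.2.1.1, h0]
  · intro i j
    simp only [V2]
    cases e1 j with
    | none => exact (e2 i).2.2.1.2.2
    | some u => simp only [Option.elim]; split_ifs; exacts [neg_mem_Fset (e2 i).2.2.1.2.1, h0]
  · intro i j
    simp only [V3]
    cases e1 i with
    | none => exact h0
    | some u => simp only [Option.elim]; split_ifs; exacts [neg_mem_Fset (zpow_emax_mem hpq), h0]
  · intro i j
    simp only [V4]
    cases e1 j with
    | none => simp only [Option.elim]; split_ifs; exacts [hK, h0]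
    | some u => simp only [Option.elim]; split_ifs; exacts [neg_mem_Fset hK, hK, h0]
  · intro i j
    simp only [V5]
    split_ifs
    exacts [neg_mem_Fset h1, h0]
  · exact fun i j => hF _ _
  intro x hx
  obtain ⟨r, rfl⟩ : ∃ r : Fin d0 → Fset p q, x = fun j => .fin (r j) := by
    have : ∀ j, ∃ r : Fset p q, x j = .fin r := by
      intro j
      have h := hx j
      generalize x j = y at h
      cases y with
      | fin r => exact ⟨⟨r, h⟩, rfl⟩
      | pinf => exact h.elim
      | ninf => exact h.elim
      | nan => exact h.elim
    choose r hr using this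
    exact ⟨r, funext hr⟩
  have hnd : ∀ {n : ℕ} {ι : Type} (e : Fin n ≃ ι), ((List.finRange n).map e).Nodup :=
    fun e => (List.nodup_finRange _).map e.injective
  have hmem : ∀ {n : ℕ} {ι : Type} (e : Fin n ≃ ι) (i : ι), i ∈ (List.finRange n).map e :=
    fun e i => List.mem_map.2 ⟨e.symm i, List.mem_finRange _, e.apply_symm_apply i⟩
  intro y1 y2 y3 y4 y5
  let g1 : Option N → ℝ := fun i => i.elim (bias₁ q) fun u => probe p q u.2.1.1 (r u.1)
  let g2 : N → ℝ := fun u => excess p q u.2 (r u.1)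
  let g3 : Option N → ℝ :=
    fun i => i.elim (bias₃ p) fun u => if margin p q u.2 (r u.1) ≤ 0 then bias₃ p else 0
  let g4 : N × Bool → ℝ := fun i => literal p q i.1.2 i.2 (r i.1.1)
  let g5 : (Fin d0 → Fset p q) → ℝ := fun z => if r = z then 1 else 0
  have L1 := relu_layer hpq (Equiv.refl (Fin d0)) e1 (W := V1) (c := bias₁ q)
    (g := fun j => (r j : ℝ)) (b := fun i => i.elim 0 fun u => rndR p q (u.2.1.1 * r u.1))
    (h := g1) (v := fun j => .fin (r j)) (fun j => rfl)
    (by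
      rintro (_ | u)
      · exact dotTo_zero hpq _ fun j => rfl
      · have := dotTo_single hpq (w := V1 (some u)) (g := fun j => (r j : ℝ)) (j₀ := u.1)
          (hnd (Equiv.refl _)) (hmem _) (fun j hj => by simp [V1, hj])
          (by simpa [V1] using abs_mul_lt_thr hpq u.2.2.2.1 (r u.1).2)
        simpa [V1] using this)
    (by
      have hle : |bias₁ q| ≤ 1 := by
        rw [abs_of_pos bias₁_pos]; exact bias₁_le_one hpq
      rintro (_ | u)
      · exact abs_add_lt_thr hpq h0 hle
      · exact abs_add_lt_thr hpq (rndR_mem hpq _) hle)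
    (by
      rintro (_ | u)
      · simp [g1, rndR_of_mem hpq hb₁, bias₁_pos.le]
      · rfl)
  have L2 := relu_layer hpq e1 e2 (W := V2) (c := 0) (g := g1)
    (b := fun u => rndR p q (margin p q u.2 (r u.1))) (h := g2) (v := y1) L1.2
    (by
      intro u
      have hα : |u.2.1.2.2 * bias₁ q| < thr p q := by
        obtain ⟨-, -, -, -, h, h'⟩ := u.2.2
        refine abs_lt_thr_of_le hpq h1 ?_
        rw [abs_of_nonneg (mul_nonneg h bias₁_pos.le), abs_one]
        exact h'
      have hv : |-u.2.1.2.1 * probe p q u.2.1.1 (r u.1)| < thr p q := by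
        obtain ⟨-, -, h, h', -⟩ := u.2.2
        refine abs_mul_lt_thr hpq ?_ (probe_mem hpq _ _)
        rw [abs_neg, abs_of_nonneg h]
        exact h'
      have := dotTo_pair hpq (w := V2 u) (g := g1) (j₁ := none) (j₂ := some u) (hnd e1) (hmem _)
        (by simp) (by rintro (_ | u') h h' <;> simp_all [V2]) (by simpa [V2, g1] using hα)
        (by simpa [V2, g1] using hv)
        (by simpa [V2, g1, margin] using abs_margin_lt_thr hpq u.2.2 (r u.1))
      simpa [V2, g1, margin] using this)
    (fun u => abs_add_lt_thr hpq (rndR_mem hpq _) (by simp))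
    (fun u => by simp only [add_zero, rndR_of_mem hpq (rndR_mem hpq _)]; rfl)
  have L3 := relu_layer hpq e2 e1 (W := V3) (c := bias₃ p) (g := g2)
    (b := fun i => i.elim 0 fun u => rndR p q (-(2 : ℝ) ^ emax q * excess p q u.2 (r u.1)))
    (h := g3) (v := y2) L2.2
    (by
      rintro (_ | u)
      · exact dotTo_zero hpq _ fun j => rfl
      · have := dotTo_single hpq (w := V3 (some u)) (g := g2) (j₀ := u) (hnd e2) (hmem _)
          (fun j hj => by simp [V3, hj])
          (by simpa [V3, g2] using (relu_amplified_excess hpq u.2.2 (r u.1)).1)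
        simpa [V3, g2] using this)
    (by
      have hle : |bias₃ p| ≤ 1 := by
        rw [abs_of_pos bias₃_pos]; exact bias₃_le_one hpq
      rintro (_ | u)
      · exact abs_add_lt_thr hpq h0 hle
      · exact abs_add_lt_thr hpq (rndR_mem hpq _) hle)
    (by
      rintro (_ | u)
      · simp [g3, rndR_of_mem hpq hb₃, bias₃_pos.le]
      · exact (relu_amplified_excess hpq u.2.2 (r u.1)).2)
  have hthr1 : (1 : ℝ) < thr p q := by simpa using abs_lt_thr_of_le hpq h1 le_rfl
  have L4 := relu_layer hpq e1 e4 (W := V4) (c := 0) (g := g3)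
    (b := g4) (h := g4) (v := y3) L3.2
    (by
      rintro ⟨u, β⟩
      have hB := zpow_pred_mul_bias₃ (p := p)
      have hR0 := rndR_of_mem hpq h0
      have hR1 := rndR_of_mem hpq h1
      have hRn := rndR_of_mem hpq (neg_mem_Fset h1)
      have hthr := thr_pos hpq
      have := dotTo_pair hpq (w := V4 (u, β)) (g := g3) (j₁ := none) (j₂ := some u) (hnd e1)
        (hmem _) (by simp) (by rintro (_ | u') h h' <;> simp_all [V4])
        (by cases β <;> simp [V4, g3, hB, hthr1, hthr])
        (by cases β <;> by_cases hm : margin p q u.2 (r u.1) ≤ 0 <;>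
              simp [V4, g3, hB, hm, hthr1, hthr])
        (by cases β <;> by_cases hm : margin p q u.2 (r u.1) ≤ 0 <;>
              simp [V4, g3, hB, hm, hthr1, hthr, hR0, hR1, hRn])
      convert this using 1
      cases β <;> by_cases hm : margin p q u.2 (r u.1) ≤ 0 <;>
        simp [V4, g3, g4, literal, hB, hm, hR0, hR1, hRn])
    (fun i => by
      rcases literal_eq_zero_or_one (p := p) (q := q) i.1.2 i.2 (r i.1.1) with h | h <;>
        simp [g4, h, hthr1, thr_pos hpq])
    (fun i => by
      rcases literal_eq_zero_or_one (p := p) (q := q) i.1.2 i.2 (r i.1.1) with h | h <;>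
        simp [g4, h, rndR_of_mem hpq h0, rndR_of_mem hpq h1])
  have hsum5 : ∀ z : Fin d0 → Fset p q, ∃ b ∈ Fset p q,
      DotTo p q ((List.finRange _).map e4) (V5 z) g4 b ∧ max (rndR p q (b + 1)) 0 = g5 z := by
    intro z
    have hprod : ∀ i, V5 z i * g4 i = 0 ∨ V5 z i * g4 i = -1 := by
      intro i
      rcases literal_eq_zero_or_one (p := p) (q := q) i.1.2 i.2 (r i.1.1) with h | h <;>
        simp only [V5, g4, h] <;> split_ifs <;> simp
    have hround : ∀ i, rndR p q (V5 z i * g4 i) = V5 z i * g4 i := by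
      intro i
      rcases hprod i with h | h <;> rw [h]
      exacts [rndR_of_mem hpq h0, rndR_of_mem hpq (neg_mem_Fset h1)]
    obtain ⟨s, hs, hto, hz, hn⟩ := sumTo_nonpos hpq (a := fun i => rndR p q (V5 z i * g4 i))
      (hmem e4) (fun i => by rw [hround]; exact hprod i)
    refine ⟨s, hs, ⟨fun i => ?_, hto⟩, ?_⟩
    · rcases hprod i with h | h <;> rw [h] <;> simp [hthr1, thr_pos hpq]
    · by_cases hrz : r = z
      · have : s = 0 := hz fun i => by
          rw [hround]
          simp only [V5, g4, hrz]
          split_ifs with h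
          · rw [h, mul_zero]
          · rw [zero_mul]
        simp [g5, hrz, this, rndR_of_mem hpq h1]
      · obtain ⟨j, hj⟩ := Function.ne_iff.1 hrz
        obtain ⟨l, hl, β, hlz, hlr⟩ := exists_literal hpq (r j).2 (z j).2
          (fun h => hj (Subtype.ext h))
        have : s ≤ -1 := hn ⟨((j, ⟨l, hl⟩), β), by rw [hround]; simp [V5, g4, hlz, hlr]⟩
        simp only [g5, hrz, if_false]
        exact max_eq_right (rndR_le hpq h0 (by linarith))
  choose b5 hb5 hdot5 hg5 using hsum5
  have L5 := relu_layer hpq e4 e5 (W := V5) (c := 1) (g := g4) (b := b5) (h := g5) (v := y4) L4.2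
    hdot5 (fun z => abs_add_lt_thr hpq (hb5 z) (by simp)) hg5
  have L6 := affine_layer hpq e5 (Equiv.refl (Fin d6)) (W := V6) (c := 0) (g := g5)
    (b := fun i => F r i) (v := y5) L5.2
    (fun i => by
      refine ⟨fun z => ?_, ?_⟩
      · by_cases h : r = z
        · simpa [V6, g5, h] using abs_lt_thr_of_le hpq (hF z i) le_rfl
        · simpa [g5, h] using thr_pos hpq
      · have := sumTo_single hpq (a := fun z => rndR p q (V6 i z * g5 z)) (i₀ := r) (hnd e5)
          (hmem e5) (rndR_mem hpq _) (fun z hz => by simp [g5, Ne.symm hz, rndR_of_mem hpq h0])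
        simpa [V6, g5, rndR_of_mem hpq (hF r i)] using this)
    (fun i => abs_add_lt_thr hpq (hF r i) (by simp))
  refine ⟨funext fun i => ?_, L1.1, L2.1, L3.1, L4.1, L5.1, L6.1⟩
  rw [hfF r i]
  simpa [rndR_of_mem hpq (hF r i)] using L6.2 i

end FPT

/-- Lemma `fnn-univ-approx`. Every function `𝔽^{d₀} → 𝔽^{d₆}` is
exactly representable by a six-layer floating-point ReLU network with all intermediate
values finite. -/
theorem stmt18 (p q : ℕ) (hp : 2 ≤ p) (hpq : (p : ℤ) ≤ 2 ^ (q - 1) - 3)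
    (d0 d6 : ℕ) (hd0 : 0 < d0) (hd6 : 0 < d6)
    (fstar : (Fin d0 → FPT.EF) → Fin d6 → FPT.EF)
    (hfs : ∀ x : Fin d0 → FPT.EF, FPT.VecFin p q x → FPT.VecFin p q (fstar x)) :
    ∃ (d1 d2 d3 d4 d5 : ℕ)
      (W1 : Fin d1 → Fin d0 → ℝ) (c1 : ℝ) (W2 : Fin d2 → Fin d1 → ℝ) (c2 : ℝ)
      (W3 : Fin d3 → Fin d2 → ℝ) (c3 : ℝ) (W4 : Fin d4 → Fin d3 → ℝ) (c4 : ℝ)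
      (W5 : Fin d5 → Fin d4 → ℝ) (c5 : ℝ) (W6 : Fin d6 → Fin d5 → ℝ) (c6 : ℝ),
      (∀ i j, W1 i j ∈ FPT.Fset p q) ∧ c1 ∈ FPT.Fset p q ∧
      (∀ i j, W2 i j ∈ FPT.Fset p q) ∧ c2 ∈ FPT.Fset p q ∧
      (∀ i j, W3 i j ∈ FPT.Fset p q) ∧ c3 ∈ FPT.Fset p q ∧
      (∀ i j, W4 i j ∈ FPT.Fset p q) ∧ c4 ∈ FPT.Fset p q ∧
      (∀ i j, W5 i j ∈ FPT.Fset p q) ∧ c5 ∈ FPT.Fset p q ∧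
      (∀ i j, W6 i j ∈ FPT.Fset p q) ∧ c6 ∈ FPT.Fset p q ∧
      ∀ x : Fin d0 → FPT.EF, FPT.VecFin p q x →
        let y1 := fun i => FPT.frelu p q (FPT.affApply p q W1 c1 x i)
        let y2 := fun i => FPT.frelu p q (FPT.affApply p q W2 c2 y1 i)
        let y3 := fun i => FPT.frelu p q (FPT.affApply p q W3 c3 y2 i)
        let y4 := fun i => FPT.frelu p q (FPT.affApply p q W4 c4 y3 i)
        let y5 := fun i => FPT.frelu p q (FPT.affApply p q W5 c5 y4 i)
        FPT.affApply p q W6 c6 y5 = fstar x ∧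
        FPT.AffIntermFin p q W1 c1 x ∧ FPT.AffIntermFin p q W2 c2 y1 ∧
        FPT.AffIntermFin p q W3 c3 y2 ∧ FPT.AffIntermFin p q W4 c4 y3 ∧
        FPT.AffIntermFin p q W5 c5 y4 ∧ FPT.AffIntermFin p q W6 c6 y5 := by
  refine FPT.exists_six_layer_network ⟨hp, ?_⟩ d0 d6 fstar hfs
  unfold FPT.emin
  linarith
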